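/- Suppose φ is Sturmian and of unbounded type (every vertex has an infinite type set). Then: (i) if two vertices x and y satisfy Λ(x) = Λ(y), then x and y are in the same class; (ii) for every vertex x, the set {Λ(y) : y ∈ V(T), d(x,y) = 1, Λ(y) ≠ Λ(x)} has at most two elements; (iii) there is at most one type set S occurring as S = Λ(x) for some vertex x such that the set {Λ(y) : y ∈ V(T), d(x,y) = 1, Λ(y) ≠ S} has exactly one element. -/

import Mathlib

open SimpleGraph

/-- Equivalence of colored `n`-balls around `x` and `y`: a graph isomorphism between the
induced subgraphs on the balls, sending center to center and preserving the coloring. -/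
def BallEquiv {V A : Type*} (T : SimpleGraph V) (φ : V → A) (n : ℕ) (x y : V) : Prop :=
  ∃ f : {v : V // T.dist x v ≤ n} ≃ {v : V // T.dist y v ≤ n},
    ((f ⟨x, by simp [SimpleGraph.dist_self]⟩ : {v : V // T.dist y v ≤ n}) : V) = y ∧
    (∀ u w : {v : V // T.dist x v ≤ n}, T.Adj (u : V) (w : V) ↔ T.Adj (f u : V) (f w : V)) ∧
    ∀ v : {v : V // T.dist x v ≤ n}, φ (f v : V) = φ (v : V)

/-- Two vertices are in the same class if a color-preserving automorphism of `T`
sends one to the other. -/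
def SameClass {V A : Type*} (T : SimpleGraph V) (φ : V → A) (x y : V) : Prop :=
  ∃ g : V ≃ V, (∀ u w : V, T.Adj (g u) (g w) ↔ T.Adj u w) ∧ g x = y ∧ ∀ v, φ (g v) = φ v

/-- Subword complexity: the number of equivalence classes of colored `n`-balls. -/
noncomputable def ballComplexity {V A : Type*} (T : SimpleGraph V) (φ : V → A) (n : ℕ) : ℕ :=
  Nat.card (Quot (BallEquiv T φ n))

/-- A coloring is periodic if it is invariant under a subgroup of the automorphism group
of `T` having finitely many orbits on vertices. -/
def IsPeriodicColoring {V A : Type*} (T : SimpleGraph V) (φ : V → A) : Prop :=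
  ∃ Γ : Subgroup (Equiv.Perm V),
    (∀ γ ∈ Γ, ∀ u w : V, T.Adj (γ u) (γ w) ↔ T.Adj u w) ∧
    (∀ γ ∈ Γ, ∀ v, φ (γ v) = φ v) ∧
    Finite (Quot (fun x y : V => ∃ γ ∈ Γ, γ x = y))

/-- The colored `n`-ball around `x` is special. -/
def IsSpecial {V A : Type*} (T : SimpleGraph V) (φ : V → A) (n : ℕ) (x : V) : Prop :=
  ∃ y z : V, BallEquiv T φ n x y ∧ BallEquiv T φ n x z ∧ ¬ BallEquiv T φ (n + 1) y z

/-- The type set of a vertex. -/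
def TypeSet {V A : Type*} (T : SimpleGraph V) (φ : V → A) (x : V) : Set ℕ :=
  {n : ℕ | IsSpecial T φ n x}

/-- The maximal type of a vertex of bounded type (`-1` if the type set is empty). -/
noncomputable def maxType {V A : Type*} (T : SimpleGraph V) (φ : V → A) (x : V) : ℤ :=
  sSup (insert (-1) ((fun n : ℕ => (n : ℤ)) '' TypeSet T φ x))

/-- The coloring is Sturmian if its subword complexity is `n + 2`. -/
def IsSturmian {V A : Type*} (T : SimpleGraph V) (φ : V → A) : Prop :=
  ∀ n : ℕ, ballComplexity T φ n = n + 2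

/-- Eventually periodic coloring. -/
def IsEventuallyPeriodic {V A : Type*} (T : SimpleGraph V) (φ : V → A) : Prop :=
  ∃ K : Set V, K.Nonempty ∧ K.Finite ∧ (T.induce K).Connected ∧
    ∀ v : (Kᶜ : Set V), ∃ ψ : V → A, IsPeriodicColoring T ψ ∧
      ∀ w : (Kᶜ : Set V), (T.induce (Kᶜ : Set V)).Reachable v w → ψ (w : V) = φ (w : V)

/-- The vertex set of the `n`-branch from `x` towards its neighbor `x'`. -/
def branchSet {V : Type*} (T : SimpleGraph V) (n : ℕ) (x x' : V) : Set V :=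
  insert x {y : V | T.dist x y ≤ n ∧ T.dist y x' < T.dist y x}

/-- Equivalence of colored `n`-branches. -/
def BranchEquiv {V A : Type*} (T : SimpleGraph V) (φ : V → A) (n : ℕ)
    (x x' y y' : V) : Prop :=
  ∃ f : (branchSet T n x x') ≃ (branchSet T n y y'),
    ((f ⟨x, Set.mem_insert x _⟩ : (branchSet T n y y')) : V) = y ∧
    (∀ u w : (branchSet T n x x'), T.Adj (u : V) (w : V) ↔ T.Adj (f u : V) (f w : V)) ∧
    ∀ v : (branchSet T n x x'), φ (f v : V) = φ (v : V)

/-- A coloring of `K` appears exactly once if the only connected subgraph of `T`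
color-isomorphic to it is `K` itself. -/
def AppearsOnce {V A : Type*} (T : SimpleGraph V) (φ : V → A) (K : Set V) : Prop :=
  ∀ K' : Set V, (T.induce K').Connected →
    (∃ f : K ≃ K', (∀ u w : K, T.Adj (u : V) (w : V) ↔ T.Adj (f u : V) (f w : V)) ∧
      ∀ v : K, φ (f v : V) = φ (v : V)) → K' = K

/-- A color-preserving isomorphism between two balls, presented by a pair of maps on the whole
vertex set that are mutually inverse on the balls. -/
structure IsBallIso {V A : Type*} (T : SimpleGraph V) (φ : V → A) (n : ℕ) (x y : V)
    (f g : V → V) : Prop where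
  map_center : f x = y
  map_ball : ∀ v, T.dist x v ≤ n → T.dist y (f v) ≤ n
  inv_map_ball : ∀ w, T.dist y w ≤ n → T.dist x (g w) ≤ n
  left_inv : ∀ v, T.dist x v ≤ n → g (f v) = v
  right_inv : ∀ w, T.dist y w ≤ n → f (g w) = w
  adj_iff : ∀ u v, T.dist x u ≤ n → T.dist x v ≤ n → (T.Adj u v ↔ T.Adj (f u) (f v))
  map_color : ∀ v, T.dist x v ≤ n → φ (f v) = φ v

namespace IsBallIso

variable {V A : Type*} {T : SimpleGraph V} {φ : V → A} {n : ℕ} {x y z : V} {f g f' g' : V → V}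

theorem refl (T : SimpleGraph V) (φ : V → A) (n : ℕ) (x : V) : IsBallIso T φ n x x id id := by
  constructor <;> simp

theorem symm (h : IsBallIso T φ n x y f g) : IsBallIso T φ n y x g f where
  map_center := by rw [← h.map_center]; exact h.left_inv x (by simp)
  map_ball := h.inv_map_ball
  inv_map_ball := h.map_ball
  left_inv := h.right_inv
  right_inv := h.left_inv
  adj_iff u v hu hv := by
    rw [h.adj_iff _ _ (h.inv_map_ball u hu) (h.inv_map_ball v hv), h.right_inv u hu,
      h.right_inv v hv]
  map_color v hv := by
    rw [← h.map_color _ (h.inv_map_ball v hv), h.right_inv v hv]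

theorem trans (h : IsBallIso T φ n x y f g) (h' : IsBallIso T φ n y z f' g') :
    IsBallIso T φ n x z (f' ∘ f) (g ∘ g') where
  map_center := by simp [h.map_center, h'.map_center]
  map_ball v hv := h'.map_ball _ (h.map_ball v hv)
  inv_map_ball w hw := h.inv_map_ball _ (h'.inv_map_ball w hw)
  left_inv v hv := by
    simp only [Function.comp_apply]
    rw [h'.left_inv _ (h.map_ball v hv), h.left_inv v hv]
  right_inv w hw := by
    simp only [Function.comp_apply]
    rw [h.right_inv _ (h'.inv_map_ball w hw), h'.right_inv w hw]
  adj_iff u v hu hv :=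
    (h.adj_iff u v hu hv).trans (h'.adj_iff _ _ (h.map_ball u hu) (h.map_ball v hv))
  map_color v hv := (h'.map_color _ (h.map_ball v hv)).trans (h.map_color v hv)

theorem dist_le (hT : T.Connected) (h : IsBallIso T φ n x y f g) {u : V} {j : ℕ}
    (hu : T.dist x u + j ≤ n) {v : V} (hv : T.dist u v ≤ j) : T.dist (f u) (f v) ≤ j := by
  induction j generalizing v with
  | zero =>
    have : u = v := (hT.preconnected u v).dist_eq_zero_iff.1 (by omega)
    simp [this]
  | succ j ih =>
    rcases Nat.lt_or_ge (T.dist u v) (j + 1) with hlt | hge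
    · exact (ih (by omega) (by omega)).trans (by omega)
    · obtain ⟨p, hp⟩ := hT.exists_walk_length_eq_dist v u
      rw [SimpleGraph.dist_comm] at hp
      cases p with
      | nil => simp
      | @cons _ w _ hvw q =>
        have hq : T.dist u w ≤ j := by
          rw [SimpleGraph.dist_comm]
          refine (SimpleGraph.dist_le q).trans ?_
          simp only [SimpleGraph.Walk.length_cons] at hp
          omega
        have hxw : T.dist x w ≤ T.dist x u + T.dist u w := hT.dist_triangle
        have hxv : T.dist x v ≤ T.dist x u + T.dist u v := hT.dist_triangle
        have hadj := (h.adj_iff w v (by omega) (by omega)).1 hvw.symm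
        have h1 : T.dist (f w) (f v) = 1 := SimpleGraph.dist_eq_one_iff_adj.2 hadj
        have h2 : T.dist (f u) (f v) ≤ T.dist (f u) (f w) + T.dist (f w) (f v) :=
          hT.dist_triangle
        have h3 := ih (by omega) hq
        omega

/-- A ball isomorphism restricts to every smaller ball inside. -/
theorem restrict (hT : T.Connected) (h : IsBallIso T φ n x y f g) {u : V} {m : ℕ}
    (hu : T.dist x u + m ≤ n) : IsBallIso T φ m u (f u) f g := by
  have hsub : ∀ v, T.dist u v ≤ m → T.dist x v ≤ n := fun v hv => by
    have : T.dist x v ≤ T.dist x u + T.dist u v := hT.dist_triangle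
    omega
  have hfu : T.dist y (f u) ≤ T.dist x u := by
    have := h.dist_le hT (u := x) (v := u) (j := T.dist x u) (by simp; omega) le_rfl
    rwa [h.map_center] at this
  have hsub' : ∀ w, T.dist (f u) w ≤ m → T.dist y w ≤ n := fun w hw => by
    have : T.dist y w ≤ T.dist y (f u) + T.dist (f u) w := hT.dist_triangle
    omega
  refine ⟨rfl, fun v hv => h.dist_le hT hu hv, fun w hw => ?_, fun v hv => h.left_inv v (hsub v hv),
    fun w hw => h.right_inv w (hsub' w hw), fun a b ha hb => h.adj_iff a b (hsub a ha) (hsub b hb),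
    fun v hv => h.map_color v (hsub v hv)⟩
  have := h.symm.dist_le hT (u := f u) (j := m) (by omega) hw
  rwa [h.left_inv u (by omega)] at this

end IsBallIso

section BallEquiv

variable {V A : Type*} {T : SimpleGraph V} {φ : V → A} {n m : ℕ} {x y z : V}

theorem ballEquiv_iff : BallEquiv T φ n x y ↔ ∃ f g, IsBallIso T φ n x y f g := by
  classical
  constructor
  · rintro ⟨e, hc, ha, hφ⟩
    refine ⟨fun v => if h : T.dist x v ≤ n then e ⟨v, h⟩ else v,
      fun w => if h : T.dist y w ≤ n then e.symm ⟨w, h⟩ else w, ?_⟩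
    have h1 : ∀ v : {v // T.dist x v ≤ n}, T.dist y (e v) ≤ n := fun v => (e v).2
    have h2 : ∀ v : {v // T.dist y v ≤ n}, T.dist x (e.symm v) ≤ n := fun v => (e.symm v).2
    constructor
    · simpa using hc
    · intro v hv; simp only [hv, dif_pos]; exact h1 _
    · intro v hv; simp only [hv, dif_pos]; exact h2 _
    · intro v hv; simp [hv, h1]
    · intro v hv; simp [hv, h2]
    · intro u v hu hv; simpa [hu, hv] using ha ⟨u, hu⟩ ⟨v, hv⟩
    · intro v hv; simpa [hv] using hφ ⟨v, hv⟩
  · rintro ⟨f, g, h⟩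
    exact ⟨⟨fun v => ⟨f v, h.map_ball v v.2⟩, fun w => ⟨g w, h.inv_map_ball w w.2⟩,
      fun v => Subtype.ext (h.left_inv v v.2), fun w => Subtype.ext (h.right_inv w w.2)⟩,
      h.map_center, fun u w => h.adj_iff u w u.2 w.2, fun v => h.map_color v v.2⟩

theorem BallEquiv.refl (T : SimpleGraph V) (φ : V → A) (n : ℕ) (x : V) : BallEquiv T φ n x x :=
  ballEquiv_iff.2 ⟨_, _, IsBallIso.refl T φ n x⟩

theorem BallEquiv.symm (h : BallEquiv T φ n x y) : BallEquiv T φ n y x := by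
  obtain ⟨f, g, h⟩ := ballEquiv_iff.1 h
  exact ballEquiv_iff.2 ⟨_, _, h.symm⟩

theorem BallEquiv.trans (h : BallEquiv T φ n x y) (h' : BallEquiv T φ n y z) :
    BallEquiv T φ n x z := by
  obtain ⟨f, g, h⟩ := ballEquiv_iff.1 h
  obtain ⟨f', g', h'⟩ := ballEquiv_iff.1 h'
  exact ballEquiv_iff.2 ⟨_, _, h.trans h'⟩

theorem BallEquiv.mono (hT : T.Connected) (hmn : m ≤ n) (h : BallEquiv T φ n x y) :
    BallEquiv T φ m x y := by
  obtain ⟨f, g, h⟩ := ballEquiv_iff.1 h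
  have := h.restrict hT (u := x) (m := m) (by simpa using hmn)
  rw [h.map_center] at this
  exact ballEquiv_iff.2 ⟨_, _, this⟩

theorem BallEquiv.exists_adj (hT : T.Connected) (h : BallEquiv T φ (n + 1) x y) {u : V}
    (hu : T.Adj x u) : ∃ w, T.Adj y w ∧ BallEquiv T φ n u w := by
  obtain ⟨f, g, h⟩ := ballEquiv_iff.1 h
  have hd : T.dist x u = 1 := SimpleGraph.dist_eq_one_iff_adj.2 hu
  refine ⟨f u, ?_, ballEquiv_iff.2 ⟨f, g, h.restrict hT (by omega)⟩⟩
  have := (h.adj_iff x u (by simp) (by omega)).1 hu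
  rwa [h.map_center] at this

theorem ballEquiv_equivalence (T : SimpleGraph V) (φ : V → A) (n : ℕ) :
    Equivalence (BallEquiv T φ n) :=
  ⟨BallEquiv.refl T φ n, BallEquiv.symm, BallEquiv.trans⟩

theorem quot_mk_eq_iff_ballEquiv :
    Quot.mk (BallEquiv T φ n) x = Quot.mk (BallEquiv T φ n) y ↔ BallEquiv T φ n x y :=
  ⟨fun h => (ballEquiv_equivalence T φ n).eqvGen_iff.1 (Quot.eqvGen_exact h), fun h => Quot.sound h⟩

theorem IsSpecial.congr (h : BallEquiv T φ n x y) (hx : IsSpecial T φ n x) : IsSpecial T φ n y := by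
  obtain ⟨a, b, ha, hb, hab⟩ := hx
  exact ⟨a, b, h.symm.trans ha, h.symm.trans hb, hab⟩

theorem BallEquiv.succ_of_not_isSpecial (hx : ¬ IsSpecial T φ n x) (h : BallEquiv T φ n x y) :
    BallEquiv T φ (n + 1) x y := by
  by_contra hc
  exact hx ⟨x, y, BallEquiv.refl T φ n x, h, hc⟩

theorem typeSet_eq_of_forall_ballEquiv (h : ∀ n, BallEquiv T φ n x y) :
    TypeSet T φ x = TypeSet T φ y := by
  ext n
  exact ⟨IsSpecial.congr (h n), IsSpecial.congr (h n).symm⟩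

end BallEquiv

/-- A surjection onto a set with one element less has only one nontrivial fiber. -/
theorem eq_of_surjective_of_card_eq_succ {α β : Type*} [Finite α] {f : α → β}
    (hf : Function.Surjective f) (hcard : Nat.card α = Nat.card β + 1) {a a' b b' : α}
    (ha : a ≠ a') (hfa : f a = f a') (hb : b ≠ b') (hfb : f b = f b') : f a = f b := by
  classical
  by_contra hab
  have : Fintype α := Fintype.ofFinite α
  have : Finite β := Finite.of_surjective f hf
  have : Fintype β := Fintype.ofFinite β
  have hne : a ≠ b := fun h => hab (by rw [h])
  have hsub : (Finset.univ : Finset β) ⊆ ((Finset.univ.erase a).erase b).image f := by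
    intro c _
    obtain ⟨d, rfl⟩ := hf c
    rw [Finset.mem_image]
    by_cases hda : d = a
    · refine ⟨a', ?_, by rw [hda, hfa]⟩
      simp only [Finset.mem_erase, Finset.mem_univ, and_true]
      exact ⟨fun h => hab (by rw [hfa, h]), ha.symm⟩
    · by_cases hdb : d = b
      · refine ⟨b', ?_, by rw [hdb, hfb]⟩
        simp only [Finset.mem_erase, Finset.mem_univ, and_true]
        exact ⟨hb.symm, fun h => hab (by rw [hfb, h])⟩
      · exact ⟨d, by simp [hda, hdb], rfl⟩
  have h1 := (Finset.card_le_card hsub).trans Finset.card_image_le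
  rw [Finset.card_erase_of_mem (by simp [hne.symm]), Finset.card_erase_of_mem (by simp)] at h1
  simp only [Finset.card_univ, Nat.card_eq_fintype_card] at h1 hcard
  have : 0 < Fintype.card α - 1 := by
    have : 1 < Fintype.card α := Fintype.one_lt_card_iff.2 ⟨a, b, hne⟩
    omega
  omega

/-- In a graph whose vertices have at most two neighbors, a path ending at a vertex with at most one
neighbor contains all neighbors of its vertices other than the initial one. -/
theorem SimpleGraph.Walk.IsPath.mem_support_of_adj {W : Type*} {Q : SimpleGraph W}
    (hdeg : ∀ a b c d, Q.Adj a b → Q.Adj a c → Q.Adj a d → b = c ∨ b = d ∨ c = d)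
    {v : W} (hv : ∀ b c, Q.Adj v b → Q.Adj v c → b = c) {u : W} {p : Q.Walk u v} (hp : p.IsPath) :
    ∀ w ∈ p.support, w ≠ u → ∀ c, Q.Adj w c → c ∈ p.support := by
  induction p with
  | nil => intro w hw hwu; simp at hw; exact absurd hw hwu
  | @cons u e v h p ih =>
    rw [SimpleGraph.Walk.cons_isPath_iff] at hp
    intro w hw hwu c hc
    rw [SimpleGraph.Walk.support_cons, List.mem_cons] at hw ⊢
    have hwp : w ∈ p.support := hw.resolve_left hwu
    by_cases hwe : w = e
    · subst hwe
      cases p with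
      | nil => exact Or.inl (hv _ _ hc h.symm)
      | @cons _ d _ h' q =>
        rcases hdeg _ _ _ _ hc h.symm h' with rfl | rfl | rfl
        · exact Or.inl rfl
        · right; simp
        · exact absurd (by simp) hp.2
    · exact Or.inr (ih hv hp.1 w hwp hwe c hc)

section Regular

variable {V A : Type*} {T : SimpleGraph V} {φ : V → A}

theorem finite_setOf_dist_le (hT : T.Connected) (hfin : ∀ v, (T.neighborSet v).Finite) (x : V)
    (n : ℕ) : {v | T.dist x v ≤ n}.Finite := by
  induction n with
  | zero =>
    refine (Set.finite_singleton x).subset fun v hv => ?_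
    exact ((hT.preconnected x v).dist_eq_zero_iff.1 (Nat.le_zero.1 hv)).symm
  | succ n ih =>
    refine (ih.union (ih.biUnion fun v _ => hfin v)).subset fun v hv => ?_
    obtain ⟨p, hp⟩ := hT.exists_walk_length_eq_dist v x
    rw [SimpleGraph.dist_comm] at hp
    cases p with
    | nil => left; simp
    | @cons _ w _ h q =>
      right
      simp only [Set.mem_iUnion, Set.mem_ofPred_eq]
      refine ⟨w, ?_, h.symm⟩
      rw [SimpleGraph.dist_comm]
      refine (SimpleGraph.dist_le q).trans ?_
      simp only [SimpleGraph.Walk.length_cons, Set.mem_ofPred_eq] at hp hv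
      omega

/-- If all balls around two vertices are equivalent, the two vertices are in the same class. -/
theorem sameClass_of_forall_ballEquiv (hT : T.Connected)
    (hfin : ∀ v, (T.neighborSet v).Finite) {x y : V} (h : ∀ n, BallEquiv T φ n x y) :
    SameClass T φ x y := by
  choose f g hfg using fun n => ballEquiv_iff.1 (h n)
  let U : Ultrafilter ℕ := Filter.hyperfilter ℕ
  have hlarge : ∀ N : ℕ, ∀ᶠ n in (U : Filter ℕ), N ≤ n := fun N =>
    Nat.hyperfilter_le_atTop (Filter.eventually_ge_atTop N)
  have hlim : ∀ {a b : V} (F G : ℕ → V → V), (∀ n, IsBallIso T φ n a b (F n) (G n)) →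
      ∀ v, ∃ w, ∀ᶠ n in (U : Filter ℕ), F n v = w := by
    intro a b F G hFG v
    have hmem : ∀ᶠ n in (U : Filter ℕ), F n v ∈ {w | T.dist b w ≤ T.dist a v} := by
      filter_upwards [hlarge (T.dist a v)] with n hn
      have := (hFG n).dist_le hT (u := a) (v := v) (j := T.dist a v) (by simpa using hn) le_rfl
      rwa [(hFG n).map_center] at this
    have hfinite := finite_setOf_dist_le hT hfin b (T.dist a v)
    have h2 : ∀ᶠ n in (U : Filter ℕ), ∃ w ∈ {w | T.dist b w ≤ T.dist a v}, F n v = w :=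
      hmem.mono fun n hn => ⟨_, hn, rfl⟩
    obtain ⟨w, -, hw⟩ := (Ultrafilter.eventually_exists_mem_iff hfinite).1 h2
    exact ⟨w, hw⟩
  choose F hF using hlim f g hfg
  choose G hG using hlim g f fun n => (hfg n).symm
  refine ⟨⟨F, G, fun v => ?_, fun w => ?_⟩, fun u w => ?_, ?_, fun v => ?_⟩
  · obtain ⟨n, h1, h2, h3⟩ := ((hF v).and ((hG (F v)).and (hlarge (T.dist x v)))).exists
    rw [← h2, ← h1, (hfg n).left_inv v h3]
  · obtain ⟨n, h1, h2, h3⟩ := ((hG w).and ((hF (G w)).and (hlarge (T.dist y w)))).exists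
    rw [← h2, ← h1, (hfg n).right_inv w h3]
  · obtain ⟨n, h1, h2, h3, h4⟩ := ((hF u).and ((hF w).and
      ((hlarge (T.dist x u)).and (hlarge (T.dist x w))))).exists
    simp only [Equiv.coe_fn_mk]
    rw [← h1, ← h2, (hfg n).adj_iff u w h3 h4]
  · obtain ⟨n, h1⟩ := (hF x).exists
    simp only [Equiv.coe_fn_mk]
    rw [← h1, (hfg n).map_center]
  · obtain ⟨n, h1, h2⟩ := ((hF v).and (hlarge (T.dist x v))).exists
    simp only [Equiv.coe_fn_mk]
    rw [← h1, (hfg n).map_color v h2]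

theorem SameClass.forall_ballEquiv {x y : V} (hT : T.Connected) (h : SameClass T φ x y) (n : ℕ) :
    BallEquiv T φ n x y := by
  obtain ⟨e, he, rfl, hφ⟩ := h
  have hle : ∀ (e : V ≃ V), (∀ u w, T.Adj (e u) (e w) ↔ T.Adj u w) → ∀ u w,
      T.dist (e u) (e w) ≤ T.dist u w := by
    intro e he u w
    obtain ⟨p, hp⟩ := hT.exists_walk_length_eq_dist u w
    let F : T →g T := ⟨e, (he _ _).2⟩
    rw [← hp, ← p.length_map F]
    exact SimpleGraph.dist_le (p.map F)
  have hsymm : ∀ u w, T.Adj (e.symm u) (e.symm w) ↔ T.Adj u w := fun u w => by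
    rw [← he, e.apply_symm_apply, e.apply_symm_apply]
  refine ballEquiv_iff.2 ⟨e, e.symm, rfl, fun v hv => (hle e he x v).trans hv, fun w hw => ?_,
    by simp, by simp, fun u v _ _ => (he u v).symm, fun v _ => hφ v⟩
  simpa using (hle e.symm hsymm (e x) w).trans hw

theorem exists_forall_ballEquiv_of_ballEquiv (hT : T.Connected) {F : Set V} (hF : F.Finite) :
    ∃ N, ∀ a ∈ F, ∀ b ∈ F, BallEquiv T φ N a b → ∀ n, BallEquiv T φ n a b := by
  classical
  have key : ∀ p : V × V, ∃ N, BallEquiv T φ N p.1 p.2 → ∀ n, BallEquiv T φ n p.1 p.2 := by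
    intro p
    by_cases hp : ∀ n, BallEquiv T φ n p.1 p.2
    · exact ⟨0, fun _ => hp⟩
    · push Not at hp
      obtain ⟨N, hN⟩ := hp
      exact ⟨N, fun h => absurd h hN⟩
  choose M hM using key
  obtain ⟨N, hN⟩ := ((hF.prod hF).image M).bddAbove
  refine ⟨N, fun a ha b hb hab => hM (a, b) (hab.mono hT (hN ?_))⟩
  exact ⟨(a, b), ⟨ha, hb⟩, rfl⟩

theorem IsSturmian.ballEquiv_of_isSpecial (hT : T.Connected) (hst : IsSturmian T φ) {n : ℕ}
    {x y : V} (hx : IsSpecial T φ n x) (hy : IsSpecial T φ n y) : BallEquiv T φ n x y := by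
  obtain ⟨a, a', ha, ha', haa⟩ := hx
  obtain ⟨b, b', hb, hb', hbb⟩ := hy
  have : Finite (Quot (BallEquiv T φ (n + 1))) :=
    Nat.finite_of_card_ne_zero (by have := hst (n + 1); unfold ballComplexity at this; omega)
  let f : Quot (BallEquiv T φ (n + 1)) → Quot (BallEquiv T φ n) :=
    Quot.map id fun _ _ h => h.mono hT n.le_succ
  have hf : Function.Surjective f := by
    rintro ⟨v⟩
    exact ⟨Quot.mk _ v, rfl⟩
  have hcard : Nat.card (Quot (BallEquiv T φ (n + 1))) = Nat.card (Quot (BallEquiv T φ n)) + 1 := by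
    have h1 := hst (n + 1)
    have h2 := hst n
    unfold ballComplexity at h1 h2
    omega
  have := eq_of_surjective_of_card_eq_succ hf hcard
    (a := Quot.mk _ a) (a' := Quot.mk _ a') (b := Quot.mk _ b) (b' := Quot.mk _ b')
    (fun h => haa (quot_mk_eq_iff_ballEquiv.1 h))
    (quot_mk_eq_iff_ballEquiv.2 (ha.symm.trans ha'))
    (fun h => hbb (quot_mk_eq_iff_ballEquiv.1 h))
    (quot_mk_eq_iff_ballEquiv.2 (hb.symm.trans hb'))
  exact ha.trans ((quot_mk_eq_iff_ballEquiv.1 this).trans hb.symm)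

theorem IsSturmian.forall_ballEquiv_of_typeSet_eq (hT : T.Connected) (hst : IsSturmian T φ) {x y : V}
    (hinf : (TypeSet T φ x).Infinite) (h : TypeSet T φ x = TypeSet T φ y) (n : ℕ) :
    BallEquiv T φ n x y := by
  obtain ⟨m, hm, hnm⟩ := hinf.exists_gt n
  exact (hst.ballEquiv_of_isSpecial hT hm (h ▸ hm : m ∈ TypeSet T φ y)).mono hT hnm.le

theorem IsSturmian.infinite_range_typeSet (hT : T.Connected) (hst : IsSturmian T φ)
    (hub : ∀ v : V, (TypeSet T φ v).Infinite) : (Set.range (TypeSet T φ)).Infinite := by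
  intro hfin
  have : Finite (Set.range (TypeSet T φ)) := hfin
  let n := Nat.card (Set.range (TypeSet T φ))
  let q : Set.range (TypeSet T φ) → Quot (BallEquiv T φ n) := fun S => Quot.mk _ S.2.choose
  have hq : Function.Surjective q := by
    rintro ⟨v⟩
    refine ⟨⟨_, v, rfl⟩, Quot.sound ?_⟩
    exact hst.forall_ballEquiv_of_typeSet_eq hT (hub _)
      (Exists.choose_spec (⟨v, rfl⟩ : ∃ w, TypeSet T φ w = TypeSet T φ v)) n
  have h1 := Nat.card_le_card_of_surjective q hq
  have h2 := hst n
  unfold ballComplexity at h2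
  omega

/-- A vertex of unbounded type has at most two neighboring type sets other than its own. -/
theorem IsSturmian.typeSet_eq_of_adj (hT : T.Connected) (hfin : ∀ v, (T.neighborSet v).Finite)
    (hst : IsSturmian T φ) {x : V} (hx : (TypeSet T φ x).Infinite) {y₁ y₂ y₃ : V}
    (h₁ : T.Adj x y₁) (h₂ : T.Adj x y₂) (h₃ : T.Adj x y₃)
    (hx₁ : TypeSet T φ y₁ ≠ TypeSet T φ x) (hx₂ : TypeSet T φ y₂ ≠ TypeSet T φ x)
    (hx₃ : TypeSet T φ y₃ ≠ TypeSet T φ x) :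
    TypeSet T φ y₁ = TypeSet T φ y₂ ∨ TypeSet T φ y₁ = TypeSet T φ y₃ ∨
      TypeSet T φ y₂ = TypeSet T φ y₃ := by
  obtain ⟨N, hN⟩ := exists_forall_ballEquiv_of_ballEquiv (φ := φ) hT
    (finite_setOf_dist_le hT hfin x 2)
  obtain ⟨m, hm, hNm⟩ := hx.exists_gt N
  obtain ⟨M, rfl⟩ : ∃ M, m = M + 1 := ⟨m - 1, by omega⟩
  have hxF : T.dist x x ≤ 2 := by simp
  have hyF : ∀ y, T.Adj x y → T.dist x y ≤ 2 := fun y hy => by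
    rw [SimpleGraph.dist_eq_one_iff_adj.2 hy]; omega
  have hzF : ∀ y z, T.Adj x y → T.Adj y z → T.dist x z ≤ 2 := fun y z hy hz => by
    have : T.dist x z ≤ T.dist x y + T.dist y z := hT.dist_triangle
    rw [SimpleGraph.dist_eq_one_iff_adj.2 hy, SimpleGraph.dist_eq_one_iff_adj.2 hz] at this
    exact this
  obtain ⟨x', hx', hxx'⟩ : ∃ x', BallEquiv T φ (M + 1) x x' ∧ ¬ BallEquiv T φ (M + 2) x x' := by
    obtain ⟨a, b, ha, hb, hab⟩ := hm
    by_cases hxa : BallEquiv T φ (M + 2) x a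
    · exact ⟨b, hb, fun h => hab (hxa.symm.trans h)⟩
    · exact ⟨a, ha, hxa⟩
  have key : ∀ y, T.Adj x y → TypeSet T φ y ≠ TypeSet T φ x →
      IsSpecial T φ M y ∨ IsSpecial T φ (M + 2) y := by
    intro y hy hne
    by_contra! hc
    obtain ⟨hM, hM2⟩ := hc
    have hM1 : ¬ IsSpecial T φ (M + 1) y := fun hs => hne <| typeSet_eq_of_forall_ballEquiv <|
      hN y (hyF y hy) x hxF ((hst.ballEquiv_of_isSpecial hT hs hm).mono hT (by omega))
    obtain ⟨y', hy', hyy'⟩ := hx'.exists_adj hT hy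
    have hyy'' := ((hyy'.succ_of_not_isSpecial hM).succ_of_not_isSpecial hM1).succ_of_not_isSpecial
      hM2
    obtain ⟨z, hz, hx'z⟩ := hyy''.symm.exists_adj hT hy'.symm
    have hxz : BallEquiv T φ N x z := (hx'.trans (hx'z.mono hT (by omega))).mono hT (by omega)
    exact hxx' ((hN x hxF z (hzF y z hy hz) hxz (M + 2)).trans hx'z.symm)
  have same : ∀ j, N ≤ j → ∀ y z, T.Adj x y → T.Adj x z → IsSpecial T φ j y → IsSpecial T φ j z →
      TypeSet T φ y = TypeSet T φ z := fun j hj y z hy hz hsy hsz =>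
    typeSet_eq_of_forall_ballEquiv <| hN y (hyF y hy) z (hyF z hz)
      ((hst.ballEquiv_of_isSpecial hT hsy hsz).mono hT hj)
  have same₀ := same M (by omega)
  have same₂ := same (M + 2) (by omega)
  rcases key y₁ h₁ hx₁ with k₁ | k₁ <;> rcases key y₂ h₂ hx₂ with k₂ | k₂ <;>
    rcases key y₃ h₃ hx₃ with k₃ | k₃ <;> grind

end Regular

/-- The graph of type sets, two distinct type sets being joined when they occur at adjacent
vertices. -/
def typeGraph {V A : Type*} (T : SimpleGraph V) (φ : V → A) : SimpleGraph (Set ℕ) where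
  Adj S S' := S ≠ S' ∧ ∃ x y, T.Adj x y ∧ TypeSet T φ x = S ∧ TypeSet T φ y = S'
  symm := ⟨fun _ _ ⟨h, x, y, hxy, hx, hy⟩ => ⟨h.symm, y, x, hxy.symm, hy, hx⟩⟩
  loopless := ⟨fun _ h => h.1 rfl⟩

section TypeGraph

variable {V A : Type*} {T : SimpleGraph V} {φ : V → A}

theorem typeGraph_reachable (hT : T.Connected) (x y : V) :
    (typeGraph T φ).Reachable (TypeSet T φ x) (TypeSet T φ y) := by
  obtain ⟨p⟩ := hT.preconnected x y
  induction p with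
  | nil => exact SimpleGraph.Reachable.refl _
  | @cons u v w h p ih =>
    by_cases heq : TypeSet T φ u = TypeSet T φ v
    · rwa [heq]
    · exact SimpleGraph.Reachable.trans (SimpleGraph.Adj.reachable ⟨heq, u, v, h, rfl, rfl⟩) ih

theorem IsSturmian.exists_adj_of_typeGraph_adj (hT : T.Connected)
    (hfin : ∀ v, (T.neighborSet v).Finite) (hst : IsSturmian T φ)
    (hub : ∀ v : V, (TypeSet T φ v).Infinite) {x : V} {S : Set ℕ}
    (h : (typeGraph T φ).Adj (TypeSet T φ x) S) :
    ∃ y, T.Adj x y ∧ TypeSet T φ y = S ∧ S ≠ TypeSet T φ x := by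
  obtain ⟨hne, u, v, huv, hu, hv⟩ := h
  obtain ⟨e, he, heu, hφ⟩ := sameClass_of_forall_ballEquiv hT hfin
    (hst.forall_ballEquiv_of_typeSet_eq hT (hub u) hu)
  refine ⟨e v, heu ▸ (he u v).2 huv, ?_, hne.symm⟩
  rw [← hv]
  exact (typeSet_eq_of_forall_ballEquiv
    (SameClass.forall_ballEquiv hT ⟨e, he, rfl, hφ⟩)).symm

end TypeGraph

theorem stmt_19 {V A : Type*} (T : SimpleGraph V) (φ : V → A) (k : ℕ)
    (hk : 2 ≤ k) (htree : T.IsTree) (hreg : ∀ v : V, (T.neighborSet v).ncard = k)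
    (hst : IsSturmian T φ) (hub : ∀ v : V, (TypeSet T φ v).Infinite) :
    (∀ x y : V, TypeSet T φ x = TypeSet T φ y → SameClass T φ x y) ∧
    (∀ x : V, ∃ s : Finset (Set ℕ), s.card ≤ 2 ∧
      ∀ y : V, T.Adj x y → TypeSet T φ y ≠ TypeSet T φ x → TypeSet T φ y ∈ s) ∧
    (∀ x x' : V,
      (∃ S : Set ℕ,
        {S' : Set ℕ | ∃ y : V, T.Adj x y ∧ TypeSet T φ y = S' ∧ S' ≠ TypeSet T φ x} = {S}) →
      (∃ S : Set ℕ,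
        {S' : Set ℕ | ∃ y : V, T.Adj x' y ∧ TypeSet T φ y = S' ∧ S' ≠ TypeSet T φ x'} = {S}) →
      TypeSet T φ x = TypeSet T φ x') := by
  have hT := htree.connected
  have hfin : ∀ v, (T.neighborSet v).Finite := fun v =>
    Set.finite_of_ncard_pos (by rw [hreg v]; omega)
  have hadj := fun {x : V} {S : Set ℕ} =>
    hst.exists_adj_of_typeGraph_adj (x := x) (S := S) hT hfin hub
  refine ⟨fun x y h => sameClass_of_forall_ballEquiv hT hfin
    (hst.forall_ballEquiv_of_typeSet_eq hT (hub x) h), fun x => ?_, fun x x' hx hx' => ?_⟩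
  · have hW : {S | ∃ y, T.Adj x y ∧ TypeSet T φ y ≠ TypeSet T φ x ∧ TypeSet T φ y = S}.Finite := by
      refine ((hfin x).image (TypeSet T φ)).subset ?_
      rintro _ ⟨y, hy, -, rfl⟩
      exact ⟨y, hy, rfl⟩
    refine ⟨hW.toFinset, ?_, fun y hy hne => by simpa using ⟨y, hy, hne, rfl⟩⟩
    by_contra! hcard
    obtain ⟨a, b, c, ha, hb, hc, hab, hac, hbc⟩ := Finset.two_lt_card_iff.1 hcard
    simp only [Set.Finite.mem_toFinset, Set.mem_ofPred_eq] at ha hb hc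
    obtain ⟨y₁, h₁, n₁, rfl⟩ := ha
    obtain ⟨y₂, h₂, n₂, rfl⟩ := hb
    obtain ⟨y₃, h₃, n₃, rfl⟩ := hc
    rcases hst.typeSet_eq_of_adj hT hfin (hub x) h₁ h₂ h₃ n₁ n₂ n₃ with h | h | h
    exacts [hab h, hac h, hbc h]
  · by_contra hne
    have hdeg : ∀ a b c d, (typeGraph T φ).Adj a b → (typeGraph T φ).Adj a c →
        (typeGraph T φ).Adj a d → b = c ∨ b = d ∨ c = d := by
      intro a b c d hb hc hd
      obtain ⟨-, v, -, -, rfl, -⟩ := id hb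
      obtain ⟨y₁, h₁, rfl, n₁⟩ := hadj hb
      obtain ⟨y₂, h₂, rfl, n₂⟩ := hadj hc
      obtain ⟨y₃, h₃, rfl, n₃⟩ := hadj hd
      exact hst.typeSet_eq_of_adj hT hfin (hub v) h₁ h₂ h₃ n₁ n₂ n₃
    have hleaf : ∀ v, (∃ S : Set ℕ, {S' : Set ℕ | ∃ y : V, T.Adj v y ∧ TypeSet T φ y = S' ∧
        S' ≠ TypeSet T φ v} = {S}) → ∀ b c, (typeGraph T φ).Adj (TypeSet T φ v) b →
        (typeGraph T φ).Adj (TypeSet T φ v) c → b = c := by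
      rintro v ⟨S, hS⟩ b c hb hc
      have hb' : b ∈ ({S} : Set (Set ℕ)) := hS ▸ hadj hb
      have hc' : c ∈ ({S} : Set (Set ℕ)) := hS ▸ hadj hc
      exact hb'.trans hc'.symm
    obtain ⟨p, hp⟩ := (typeGraph_reachable (φ := φ) hT x x').exists_isPath
    have hclosed : ∀ w ∈ p.support, ∀ c, (typeGraph T φ).Adj w c → c ∈ p.support := by
      intro w hw c hc
      by_cases hwx : w = TypeSet T φ x
      · subst hwx
        have hrev := hp.reverse.mem_support_of_adj hdeg (hleaf x hx) _
          (by simp) hne c hc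
        simpa using hrev
      · exact hp.mem_support_of_adj hdeg (hleaf x' hx') w hw hwx c hc
    refine hst.infinite_range_typeSet hT hub (p.support.finite_toSet.subset ?_)
    rintro _ ⟨v, rfl⟩
    obtain ⟨q⟩ := typeGraph_reachable (φ := φ) hT x v
    have : ∀ {a b} (q : (typeGraph T φ).Walk a b), a ∈ p.support → b ∈ p.support := by
      intro a b q
      induction q with
      | nil => exact id
      | cons h q ih => exact fun ha => ih (hclosed _ ha _ h)
    exact this q (by simp)
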